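/- arXiv:2102.11443 — 11 statements merged into one kernel-verified Lean document; each statement's English description precedes it below -/
import Mathlib

section
/- Let κ be a nonzero cardinal and A a nonzero abelian group. Then the direct sum A^{(κ)} of κ copies of A is self-small if and only if A is self-small and κ is finite. -/
/-- `A` is `B`-small: for every index set `I`, every homomorphism `A → B^{(I)}`
has image contained in `B^{(F)}` for some finite `F ⊆ I`. -/
def IsBSmall (A : Type*) (B : Type*) [AddCommGroup A] [AddCommGroup B] : Prop :=
  ∀ (I : Type) (f : A →+ Π₀ _ : I, B), ∃ F : Finset I, ∀ (a : A) (i : I), i ∉ F → f a i = 0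

/-- `A` is self-small if `A` is `A`-small. -/
def IsSelfSmall (A : Type*) [AddCommGroup A] : Prop := IsBSmall A A

/-- The homomorphism `⊕_I B → ⊕_I C` induced by `φ : B → C` on each summand. -/
def directSumMap (I : Type*) {B C : Type*} [AddCommGroup B] [AddCommGroup C] (φ : B →+ C) :
    (Π₀ _ : I, B) →+ Π₀ _ : I, C :=
  DFinsupp.mapRange.addMonoidHom fun _ => φ

@[simp]
theorem directSumMap_apply {I B C : Type*} [AddCommGroup B] [AddCommGroup C] (φ : B →+ C)
    (x : Π₀ _ : I, B) (i : I) : directSumMap I φ x i = φ (x i) := rfl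

/-- A retract of a self-small group is self-small. -/
theorem IsSelfSmall.of_retract {A B : Type*} [AddCommGroup A] [AddCommGroup B]
    (h : IsSelfSmall B) (s : A →+ B) (r : B →+ A) (hrs : ∀ a, r (s a) = a) :
    IsSelfSmall A := by
  intro I f
  obtain ⟨F, hF⟩ := h I ((directSumMap I s).comp (f.comp r))
  refine ⟨F, fun a i hi => ?_⟩
  have key : s (f a i) = 0 := by simpa [hrs] using hF (s a) i hi
  rw [← hrs (f a i), key, map_zero]

/-- If a nontrivial direct sum of copies of `A` is self-small, its index type is finite. -/
theorem IsSelfSmall.finite_of_directSum {A K : Type} [AddCommGroup A] [Nontrivial A]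
    (h : IsSelfSmall (Π₀ _ : K, A)) : Finite K := by
  classical
  obtain ⟨a, ha⟩ := exists_ne (0 : A)
  cases isEmpty_or_nonempty K with
  | inl hK => infer_instance
  | inr hK =>
    obtain ⟨k₀⟩ := hK
    obtain ⟨F, hF⟩ := h K (directSumMap K (DFinsupp.singleAddHom (fun _ : K => A) k₀))
    refine Set.finite_univ_iff.mp (F.finite_toSet.subset fun k _ => ?_)
    by_contra hk
    exact ha (by simpa using hF (DFinsupp.single k a) k hk)

/-- A finite direct sum of copies of a self-small group is self-small. -/
theorem IsSelfSmall.directSum {A K : Type*} [AddCommGroup A] [Finite K]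
    (h : IsSelfSmall A) : IsSelfSmall (Π₀ _ : K, A) := by
  classical
  cases nonempty_fintype K
  intro I f
  choose F hF using fun k l : K => h I ((directSumMap I
    (DFinsupp.evalAddMonoidHom (β := fun _ : K => A) l)).comp
      (f.comp (DFinsupp.singleAddHom (fun _ : K => A) k)))
  refine ⟨Finset.univ.biUnion fun k => Finset.univ.biUnion (F k), fun x i hi => ?_⟩
  simp only [Finset.mem_biUnion, Finset.mem_univ, true_and, not_exists] at hi
  induction x using DFinsupp.induction with
  | h0 => simp
  | ha k a y _ _ hy =>
    ext l
    have hsingle : f (DFinsupp.single k a) i l = 0 := hF k l a i (hi k l)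
    simpa [hy] using hsingle

/-- For a nonzero cardinal `κ` (realized as a nonempty type `K`) and a nonzero
abelian group `A`, the direct sum `A^{(κ)} = Π₀ _ : K, A` is self-small if and only if
`A` is self-small and `κ` is finite. -/
theorem isSelfSmall_directSum_iff (A : Type) [AddCommGroup A] [Nontrivial A]
    (K : Type) [Nonempty K] :
    IsSelfSmall (Π₀ _ : K, A) ↔ IsSelfSmall A ∧ Finite K := by
  classical
  obtain ⟨k₀⟩ := ‹Nonempty K›
  refine ⟨fun h => ⟨h.of_retract (DFinsupp.singleAddHom (fun _ : K => A) k₀)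
    (DFinsupp.evalAddMonoidHom k₀) fun a =>
      DFinsupp.single_eq_same (β := fun _ : K => A) (b := a), h.finite_of_directSum⟩, ?_⟩
  rintro ⟨h, hK⟩
  exact h.directSum
end

section
/- Let A and B be abelian groups. The following are equivalent: (1) A is not B-small; (2) there exists a homomorphism f : A → B^{(ω)} (direct sum of countably many copies of B) such that for every n < ω, f(A) is not contained in the subgroup of elements supported on {0,…,n−1}; (3) there exists an ω-filtration (A_n)_{n<ω} of A such that for each n < ω there is a nonzero homomorphism f_n : A → B with f_n(A_n) = 0; (4) there exists an ω-filtration (A_n)_{n<ω} of A such that Hom(A/A_n, B) ≠ 0 for each n < ω. -/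
/-- An ω-filtration of `A`: an increasing chain `(C n)_{n<ω}` of subgroups of `A`
whose union is all of `A`. -/
def IsOmegaFiltration {A : Type*} [AddCommGroup A] (C : ℕ → AddSubgroup A) : Prop :=
  (∀ n, C n ≤ C (n + 1)) ∧ ∀ a : A, ∃ n, a ∈ C n

/-- A pointwise finitely supported family of homomorphisms assembles into a homomorphism
to the direct sum. -/
theorem exists_addMonoidHom_dfinsupp {ι A B : Type*} [AddCommGroup A] [AddCommGroup B]
    (φ : ι → A →+ B) (h : ∀ a, ∃ s : Finset ι, ∀ i ∉ s, φ i a = 0) :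
    ∃ g : A →+ Π₀ _ : ι, B, ∀ a i, g a i = φ i a := by
  classical
  choose s hs using h
  have key : ∀ a i, (DFinsupp.mk (s a) fun j => φ j a : Π₀ _ : ι, B) i = φ i a := by
    intro a i
    rw [DFinsupp.mk_apply]
    split_ifs with hi
    · rfl
    · exact (hs a i hi).symm
  exact ⟨AddMonoidHom.mk' (fun a => DFinsupp.mk (s a) fun j => φ j a)
    fun a b => DFinsupp.ext fun i => by rw [DFinsupp.add_apply, key, key, key, map_add],
    key⟩

/-- For abelian groups `A` and `B`, the following are equivalent:
(1) `A` is not `B`-small;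
(2) there is `f : A → B^{(ω)}` whose image is not contained in the elements supported
    on `{0,…,n−1}`, for every `n < ω`;
(3) there is an ω-filtration `(A_n)` of `A` such that for each `n` there is a nonzero
    homomorphism `f_n : A → B` vanishing on `A_n`;
(4) there is an ω-filtration `(A_n)` of `A` with `Hom(A/A_n, B) ≠ 0` for each `n`. -/
theorem not_isBSmall_tfae (A B : Type) [AddCommGroup A] [AddCommGroup B] :
    List.TFAE
      [ ¬ IsBSmall A B,
        ∃ f : A →+ Π₀ _ : ℕ, B, ∀ n : ℕ, ∃ (a : A) (i : ℕ), n ≤ i ∧ f a i ≠ 0,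
        ∃ C : ℕ → AddSubgroup A, IsOmegaFiltration C ∧
          ∀ n : ℕ, ∃ f : A →+ B, f ≠ 0 ∧ ∀ a ∈ C n, f a = 0,
        ∃ C : ℕ → AddSubgroup A, IsOmegaFiltration C ∧
          ∀ n : ℕ, ∃ g : (A ⧸ C n) →+ B, g ≠ 0 ] := by
  classical
  tfae_have 1 → 2 := by
    intro h
    simp only [IsBSmall, not_forall, not_exists] at h
    obtain ⟨I, f, hf⟩ := h
    have hinf : {i | ∃ a, f a i ≠ 0}.Infinite := by
      intro hfin
      obtain ⟨a, i, hi, hai⟩ := hf hfin.toFinset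
      exact hi (hfin.mem_toFinset.2 ⟨a, hai⟩)
    let e := hinf.natEmbedding
    obtain ⟨g, hg⟩ := exists_addMonoidHom_dfinsupp
      (fun n => (DFinsupp.evalAddMonoidHom (e n : I)).comp f) fun a =>
        ⟨(f a).support.preimage (fun n => (e n : I))
          (Subtype.val_injective.comp e.injective).injOn, fun n hn => by
            rw [Finset.mem_preimage, DFinsupp.notMem_support_iff] at hn
            exact hn⟩
    refine ⟨g, fun n => ?_⟩
    obtain ⟨a, ha⟩ := (e n).2
    exact ⟨a, n, le_rfl, fun h => ha ((hg a n).symm.trans h)⟩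
  tfae_have 2 → 3 := by
    rintro ⟨f, hf⟩
    refine ⟨fun n => ⨅ i ≥ n, ((DFinsupp.evalAddMonoidHom i).comp f).ker,
      ⟨fun n => ?_, fun a => ?_⟩, fun n => ?_⟩
    · exact le_iInf₂ fun i hi => iInf₂_le i (n.le_succ.trans hi)
    · obtain ⟨n, hn⟩ := (f a).support.exists_nat_subset_range
      refine ⟨n, ?_⟩
      simp only [AddSubgroup.mem_iInf, AddMonoidHom.mem_ker]
      intro i hi
      by_contra hne
      exact hi.not_gt (Finset.mem_range.1 (hn (DFinsupp.mem_support_iff.2 hne)))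
    · obtain ⟨a, i, hi, ha⟩ := hf n
      refine ⟨(DFinsupp.evalAddMonoidHom i).comp f, fun h => ha (DFunLike.congr_fun h a),
        fun b hb => ?_⟩
      simp only [AddSubgroup.mem_iInf, AddMonoidHom.mem_ker] at hb
      exact hb i hi
  tfae_have 3 → 1 := by
    rintro ⟨C, ⟨hmono, hunion⟩, hC⟩ hsmall
    choose φ hne hφ using hC
    obtain ⟨g, hg⟩ := exists_addMonoidHom_dfinsupp φ fun a => by
      obtain ⟨n, hn⟩ := hunion a
      exact ⟨Finset.range n, fun i hi =>
        hφ i a (monotone_nat_of_le_succ hmono (by simpa using hi) hn)⟩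
    obtain ⟨F, hF⟩ := hsmall ℕ g
    obtain ⟨n, hn⟩ := Infinite.exists_notMem_finset F
    exact hne n (AddMonoidHom.ext fun a => by rw [← hg, hF a n hn, AddMonoidHom.zero_apply])
  tfae_have 3 → 4 := by
    rintro ⟨C, hfil, hC⟩
    refine ⟨C, hfil, fun n => ?_⟩
    obtain ⟨f, hne, hf⟩ := hC n
    refine ⟨QuotientAddGroup.lift (C n) f hf, fun h => hne (AddMonoidHom.ext fun a => ?_)⟩
    exact DFunLike.congr_fun h (a : A ⧸ C n)
  tfae_have 4 → 3 := by
    rintro ⟨C, hfil, hC⟩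
    refine ⟨C, hfil, fun n => ?_⟩
    obtain ⟨g, hg⟩ := hC n
    refine ⟨g.comp (QuotientAddGroup.mk' (C n)),
      fun h => hg (QuotientAddGroup.addMonoidHom_ext _ h), fun a ha => ?_⟩
    have h0 : QuotientAddGroup.mk' (C n) a = 0 := (QuotientAddGroup.eq_zero_iff a).2 ha
    rw [AddMonoidHom.comp_apply, h0, map_zero]
  tfae_finish
end

section
/- Let A, B and C be abelian groups and I a set. If A is B-small and C embeds into the direct product B^{I} (i.e. there is an injective homomorphism C → B^{I}), then A is C-small. -/
/-- If `A` is `B`-small and `C` embeds into the direct product `B^I`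
(there is an injective homomorphism `C → B^I`), then `A` is `C`-small. -/
theorem isBSmall_of_embeds_pow (A B C : Type) [AddCommGroup A] [AddCommGroup B]
    [AddCommGroup C] (I : Type) (h : IsBSmall A B)
    (g : C →+ (I → B)) (hg : Function.Injective g) : IsBSmall A C := by
  intro J f
  have detect : ∀ j, ∃ φ : C →+ B, (∀ a, φ (f a j) = 0) → ∀ a, f a j = 0 := by
    intro j
    by_cases hj : ∀ a, f a j = 0
    · exact ⟨0, fun _ => hj⟩
    · obtain ⟨a, ha⟩ := not_forall.mp hj
      obtain ⟨i, hi⟩ := Function.ne_iff.mp ((map_ne_zero_iff g hg).mpr ha)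
      exact ⟨(Pi.evalAddMonoidHom (fun _ => B) i).comp g, fun hz => absurd (hz a) hi⟩
  choose φ hφ using detect
  obtain ⟨F, hF⟩ := h J ((DFinsupp.mapRange.addMonoidHom φ).comp f)
  exact ⟨F, fun a j hj => hφ j (fun b => by simpa using hF b j hj) a⟩
end

section
/- Let A be a self-small abelian group. Then: (1) for every index set I and every homomorphism f : A → A^{I} into the direct product of I copies of A, the image f(A) is a self-small group; (2) for every subset I of the endomorphism ring End(A), the quotient group A/⋂{ker ι | ι ∈ I} is self-small. -/
/-- A quotient of a self-small group which is cogenerated by that group is self-small. -/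
theorem IsSelfSmall.of_surjective_of_cogenerated {A B : Type*} [AddCommGroup A] [AddCommGroup B]
    (hA : IsSelfSmall A) (p : A →+ B) (hp : Function.Surjective p)
    (hB : ∀ b : B, b ≠ 0 → ∃ g : B →+ A, g b ≠ 0) : IsSelfSmall B := by
  intro J φ
  have key : ∀ j : J, ∃ g : B →+ A, (∃ b, φ b j ≠ 0) → ∃ a, g (φ (p a) j) ≠ 0 := by
    intro j
    by_cases h : ∃ b, φ b j ≠ 0
    · obtain ⟨b, hb⟩ := h
      obtain ⟨g, hg⟩ := hB _ hb
      obtain ⟨a, rfl⟩ := hp b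
      exact ⟨g, fun _ => ⟨a, hg⟩⟩
    · exact ⟨0, fun h' => absurd h' h⟩
  choose g hg using key
  obtain ⟨F, hF⟩ := hA J ((DFinsupp.mapRange.addMonoidHom g).comp (φ.comp p))
  refine ⟨F, fun b j hj => ?_⟩
  by_contra hb
  obtain ⟨a, ha⟩ := hg j ⟨b, hb⟩
  exact ha (by simpa using hF a j hj)

/-- If `A` is a self-small abelian group, then
(1) for every index set `I` and homomorphism `f : A → A^I` into the direct product,
the image `f(A)` is self-small; and
(2) for every subset `I` of `End(A)`, the quotient `A / ⋂ {ker ι | ι ∈ I}` is self-small. -/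
theorem selfSmall_image_and_quotient (A : Type) [AddCommGroup A] (hA : IsSelfSmall A) :
    (∀ (I : Type) (f : A →+ (I → A)), IsSelfSmall f.range) ∧
      (∀ I : Set (A →+ A), IsSelfSmall (A ⧸ ⨅ ι ∈ I, ι.ker)) := by
  refine ⟨fun I f => ?_, fun I => ?_⟩
  · refine hA.of_surjective_of_cogenerated f.rangeRestrict f.rangeRestrict_surjective ?_
    intro b hb
    obtain ⟨i, hi⟩ := Function.ne_iff.mp fun h : (b : I → A) = 0 => hb (Subtype.ext h)
    exact ⟨(Pi.evalAddMonoidHom (fun _ : I => A) i).comp f.range.subtype, hi⟩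
  · refine hA.of_surjective_of_cogenerated (QuotientAddGroup.mk' _)
      (QuotientAddGroup.mk'_surjective _) ?_
    intro b hb
    obtain ⟨a, rfl⟩ := QuotientAddGroup.mk'_surjective _ b
    have ha : a ∉ ⨅ ι ∈ I, ι.ker := fun h => hb ((QuotientAddGroup.eq_zero_iff a).mpr h)
    simp only [AddSubgroup.mem_iInf, not_forall] at ha
    obtain ⟨ι, hι, hιa⟩ := ha
    exact ⟨QuotientAddGroup.lift _ ι (iInf₂_le ι hι), hιa⟩
end

section
/- Let A and C be abelian groups and B a subgroup of C. If both B and the quotient C/B are A-small, then C is A-small. -/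
/-- Let `B` be a subgroup of `C`. If both `B` and `C/B` are `A`-small,
then `C` is `A`-small. -/
theorem isBSmall_of_subgroup_and_quotient (A C : Type) [AddCommGroup A] [AddCommGroup C]
    (B : AddSubgroup C) (h1 : IsBSmall B A) (h2 : IsBSmall (C ⧸ B) A) :
    IsBSmall C A := by
  classical
  intro I f
  obtain ⟨F, hF⟩ := h1 I (f.comp B.subtype)
  let g : C →+ Π₀ _ : I, A := (DFinsupp.filterAddMonoidHom (fun _ : I => A) (· ∉ F)).comp f
  have g_apply (c : C) (i : I) (hi : i ∉ F) : g c i = f c i :=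
    DFinsupp.filter_apply_pos (f c) hi
  have hg : B ≤ g.ker := by
    intro b hb
    rw [AddMonoidHom.mem_ker]
    ext i
    by_cases hi : i ∈ F
    · exact DFinsupp.filter_apply_neg (f b) (not_not.mpr hi)
    · exact (g_apply b i hi).trans (hF ⟨b, hb⟩ i hi)
  obtain ⟨G, hG⟩ := h2 I (QuotientAddGroup.lift B g hg)
  refine ⟨F ∪ G, fun c i hi => ?_⟩
  rw [Finset.mem_union, not_or] at hi
  rw [← g_apply c i hi.1]
  exact hG c i hi.2
end

section
/- Let A and C be abelian groups and B a subgroup of C. If A is B-small and A is C/B-small, then A is C-small. -/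
/-- A pointwise finitely supported family of homomorphisms into `B` is the family of coordinates
of a homomorphism into the direct sum of copies of `B`. -/
theorem AddMonoidHom.exists_dfinsupp_apply_eq {I A B : Type*} [AddCommGroup A] [AddCommGroup B]
    (φ : I → A →+ B) (hφ : ∀ a, {i | φ i a ≠ 0}.Finite) :
    ∃ g : A →+ Π₀ _ : I, B, ∀ a i, g a i = φ i a := by
  classical
  have h : ∀ a, ∃ d : Π₀ _ : I, B, ∀ i, d i = φ i a := fun a =>
    ⟨DFinsupp.mk (hφ a).toFinset fun i => φ i a, fun i => by
      by_cases hi : φ i a = 0 <;> simp [DFinsupp.mk_apply, hi]⟩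
  choose d hd using h
  exact ⟨AddMonoidHom.mk' d fun a b => by ext i; simp [hd], hd⟩

theorem IsBSmall.exists_finset_of_finite {A B : Type*} [AddCommGroup A] [AddCommGroup B]
    (h : IsBSmall A B) {I : Type} (φ : I → A →+ B) (hφ : ∀ a, {i | φ i a ≠ 0}.Finite) :
    ∃ F : Finset I, ∀ a, ∀ i ∉ F, φ i a = 0 := by
  obtain ⟨g, hg⟩ := AddMonoidHom.exists_dfinsupp_apply_eq φ hφ
  obtain ⟨F, hF⟩ := h I g
  exact ⟨F, fun a i hi => hg a i ▸ hF a i hi⟩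

/-- Let `B` be a subgroup of `C`. If `A` is `B`-small and `A` is
`C/B`-small, then `A` is `C`-small. -/
theorem isBSmall_extension (A C : Type) [AddCommGroup A] [AddCommGroup C]
    (B : AddSubgroup C) (h1 : IsBSmall A B) (h2 : IsBSmall A (C ⧸ B)) :
    IsBSmall A C := by
  classical
  intro I f
  let π : I → A →+ C := fun i => (DFinsupp.evalAddMonoidHom i).comp f
  have hπ : ∀ a, {i | π i a ≠ 0}.Finite := fun a =>
    (f a).support.finite_toSet.subset fun i hi => DFinsupp.mem_support_iff.2 hi
  obtain ⟨F, hF⟩ := h2.exists_finset_of_finite (fun i => (QuotientAddGroup.mk' B).comp (π i))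
    fun a => (hπ a).subset fun i hi h0 => hi (by simp [h0])
  have hB : ∀ a, ∀ i ∉ F, π i a ∈ B := fun a i hi =>
    (QuotientAddGroup.eq_zero_iff _).1 (hF a i hi)
  obtain ⟨G, hG⟩ := h1.exists_finset_of_finite
    (fun i => if hi : i ∉ F then (π i).codRestrict B fun a => hB a i hi else 0)
    fun a => (hπ a).subset fun i hi h0 => hi (by
      by_cases hiF : i ∈ F
      · simp [hiF]
      · simpa [hiF, Subtype.ext_iff] using h0)
  refine ⟨F ∪ G, fun a i hi => ?_⟩
  rw [Finset.notMem_union] at hi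
  have h0 : π i a = 0 := by simpa [hi.1, Subtype.ext_iff] using hG a i hi.2
  exact h0
end

section
/- Let A be an abelian group and 𝓜 a finite family of abelian groups. If A is N-small for every N ∈ 𝓜, then A is ⊕𝓜-small, where ⊕𝓜 is the direct sum of the family. -/
/-- If `𝓜 = (N j)_{j ∈ ι}` is a finite family of abelian groups and `A` is
`N j`-small for every `j`, then `A` is `⊕𝓜`-small. -/
theorem isBSmall_into_finite_directSum (A : Type) [AddCommGroup A]
    (ι : Type) [Finite ι] (N : ι → Type) [∀ j, AddCommGroup (N j)]
    (h : ∀ j, IsBSmall A (N j)) : IsBSmall A (Π₀ j, N j) := by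
  classical
  cases nonempty_fintype ι
  intro I f
  choose F hF using fun j => h j I
    ((DFinsupp.mapRange.addMonoidHom fun _ : I => DFinsupp.evalAddMonoidHom (β := N) j).comp f)
  refine ⟨Finset.univ.biUnion F, fun a i hi => DFinsupp.ext fun j => ?_⟩
  have hij : i ∉ F j := fun hj => hi (Finset.mem_biUnion.2 ⟨j, Finset.mem_univ j, hj⟩)
  simpa [DFinsupp.evalAddMonoidHom] using hF j a i hij
end

section
/- Let 𝓜 and 𝓝 be finite families of abelian groups. The following are equivalent: (1) ⊕𝓜 is ⊕𝓝-small; (2) M is ⊕𝓝-small for each M ∈ 𝓜; (3) ⊕𝓜 is N-small for each N ∈ 𝓝; (4) M is N-small for each M ∈ 𝓜 and N ∈ 𝓝; (5) for each M ∈ 𝓜, each N ∈ 𝓝, and each ω-filtration (M_i)_{i<ω} of M, there exists i < ω with Hom(M/M_i, N) = 0. -/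
section BSmall

variable {A A' B B' : Type*} [AddCommGroup A] [AddCommGroup A'] [AddCommGroup B] [AddCommGroup B']

theorem IsBSmall.of_surjective (h : IsBSmall A B) (p : A →+ A') (hp : Function.Surjective p) :
    IsBSmall A' B := by
  intro I f
  obtain ⟨F, hF⟩ := h I (f.comp p)
  refine ⟨F, fun a i hi => ?_⟩
  obtain ⟨a, rfl⟩ := hp a
  exact hF a i hi

theorem IsBSmall.of_injective (h : IsBSmall A B) (e : B' →+ B) (he : Function.Injective e) :
    IsBSmall A B' := by
  intro I f
  obtain ⟨F, hF⟩ := h I ((DFinsupp.mapRange.addMonoidHom fun _ : I => e).comp f)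
  refine ⟨F, fun a i hi => he ?_⟩
  simpa using hF a i hi

theorem IsBSmall.dfinsupp_left {ι : Type*} [Finite ι] {M : ι → Type*} [∀ j, AddCommGroup (M j)]
    (h : ∀ j, IsBSmall (M j) B) : IsBSmall (Π₀ j, M j) B := by
  classical
  have := Fintype.ofFinite ι
  intro I f
  choose F hF using fun j => h j I (f.comp (DFinsupp.singleAddHom M j))
  refine ⟨Finset.univ.biUnion F, fun a i hi => ?_⟩
  have hzero : (DFinsupp.evalAddMonoidHom i).comp f = 0 :=
    DFinsupp.addHom_ext fun j x => hF j x i fun hij =>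
      hi (Finset.mem_biUnion.2 ⟨j, Finset.mem_univ j, hij⟩)
  exact DFunLike.congr_fun hzero a

theorem IsBSmall.dfinsupp_right {κ : Type*} [Finite κ] {N : κ → Type*} [∀ k, AddCommGroup (N k)]
    (h : ∀ k, IsBSmall A (N k)) : IsBSmall A (Π₀ k, N k) := by
  classical
  have := Fintype.ofFinite κ
  intro I f
  choose F hF using fun k => h k I
    ((DFinsupp.mapRange.addMonoidHom fun _ : I => DFinsupp.evalAddMonoidHom k).comp f)
  refine ⟨Finset.univ.biUnion F, fun a i hi => ?_⟩
  ext k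
  exact hF k a i fun hik => hi (Finset.mem_biUnion.2 ⟨k, Finset.mem_univ k, hik⟩)

/-- A sequence of homomorphisms that is eventually zero at each point, as a single homomorphism
into the direct sum. -/
theorem exists_addMonoidHom_dfinsupp_s12 (g : ℕ → A →+ B) (hg : ∀ a, ∃ n, ∀ m, n ≤ m → g m a = 0) :
    ∃ f : A →+ Π₀ _ : ℕ, B, ∀ a m, f a m = g m a := by
  choose n hn using hg
  let F (a : A) : Π₀ _ : ℕ, B := DFinsupp.mk (Finset.range (n a)) fun m => g m a
  have hF (a : A) (m : ℕ) : F a m = g m a := by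
    by_cases hm : m < n a
    · simp [F, hm]
    · simp [F, hm, hn a m (not_lt.1 hm)]
  refine ⟨AddMonoidHom.mk' F fun a b => ?_, hF⟩
  ext m
  simp [hF]

theorem isBSmall_iff_forall_isOmegaFiltration : IsBSmall A B ↔
    ∀ C : ℕ → AddSubgroup A, IsOmegaFiltration C → ∃ i : ℕ, ∀ g : (A ⧸ C i) →+ B, g = 0 := by
  constructor
  · intro h C hC
    by_contra! hne
    choose g hg using hne
    have hmono : Monotone C := monotone_nat_of_le_succ hC.1
    obtain ⟨f, hf⟩ := exists_addMonoidHom_dfinsupp_s12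
      (fun n => (g n).comp (QuotientAddGroup.mk' (C n))) fun a => by
        obtain ⟨n, hn⟩ := hC.2 a
        refine ⟨n, fun m hm => ?_⟩
        have : (a : A ⧸ C m) = 0 := (QuotientAddGroup.eq_zero_iff a).2 (hmono hm hn)
        simp [this]
    obtain ⟨F, hF⟩ := h ℕ f
    obtain ⟨n, hn⟩ := Infinite.exists_notMem_finset F
    refine hg n (QuotientAddGroup.addMonoidHom_ext _ ?_)
    ext a
    exact (hf a n).symm.trans (hF a n hn)
  · classical
    intro h I f
    by_cases hS : {i | ∃ a, f a i ≠ 0}.Finite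
    · refine ⟨hS.toFinset, fun a i hi => ?_⟩
      by_contra hne
      exact hi (hS.mem_toFinset.2 ⟨a, hne⟩)
    · exfalso
      let e := Set.Infinite.natEmbedding _ hS
      let φ (m : ℕ) : A →+ B := (DFinsupp.evalAddMonoidHom (e m : I)).comp f
      let C (n : ℕ) : AddSubgroup A := ⨅ m ≥ n, (φ m).ker
      have hmem (n : ℕ) (a : A) : a ∈ C n ↔ ∀ m ≥ n, φ m a = 0 := by
        simp [C, AddSubgroup.mem_iInf]
      have hC : IsOmegaFiltration C := by
        refine ⟨fun n a ha => ?_, fun a => ?_⟩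
        · rw [hmem] at ha ⊢
          exact fun m hm => ha m (by omega)
        · have hfin : {m | φ m a ≠ 0}.Finite :=
            ((f a).finite_support.preimage
              (Subtype.val_injective.comp e.injective).injOn).subset fun m hm => hm
          obtain ⟨n, hn⟩ := hfin.bddAbove
          refine ⟨n + 1, (hmem _ _).2 fun m hm => ?_⟩
          by_contra hne
          have : m ≤ n := hn hne
          omega
      obtain ⟨n, hn⟩ := h C hC
      obtain ⟨a, ha⟩ := (e n).2
      have hker : C n ≤ (φ n).ker := fun x hx => (hmem n x).1 hx n le_rfl
      exact ha (DFunLike.congr_fun (hn (QuotientAddGroup.lift (C n) (φ n) hker)) (a : A ⧸ C n))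

end BSmall

/-- For finite families `𝓜 = (M j)_{j ∈ ι}` and `𝓝 = (N k)_{k ∈ κ}` of
abelian groups, the following are equivalent:
(1) `⊕𝓜` is `⊕𝓝`-small; (2) each `M j` is `⊕𝓝`-small; (3) `⊕𝓜` is `N k`-small for
each `k`; (4) `M j` is `N k`-small for all `j, k`; (5) for all `j, k` and every
ω-filtration `(C i)` of `M j`, there is `i` with `Hom(M j / C i, N k) = 0`. -/
theorem finite_sum_small_tfae (ι κ : Type) [Finite ι] [Finite κ]
    (M : ι → Type) (N : κ → Type) [∀ j, AddCommGroup (M j)] [∀ k, AddCommGroup (N k)] :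
    List.TFAE
      [ IsBSmall (Π₀ j, M j) (Π₀ k, N k),
        ∀ j, IsBSmall (M j) (Π₀ k, N k),
        ∀ k, IsBSmall (Π₀ j, M j) (N k),
        ∀ j k, IsBSmall (M j) (N k),
        ∀ (j : ι) (k : κ) (C : ℕ → AddSubgroup (M j)), IsOmegaFiltration C →
          ∃ i : ℕ, ∀ g : (M j ⧸ C i) →+ N k, g = 0 ] := by
  classical
  tfae_have 1 → 2 := fun h j =>
    h.of_surjective (DFinsupp.evalAddMonoidHom j) fun x =>
      ⟨DFinsupp.single j x, DFinsupp.single_eq_same (b := x)⟩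
  tfae_have 2 → 4 := fun h j k =>
    (h j).of_injective (DFinsupp.singleAddHom N k) DFinsupp.single_injective
  tfae_have 4 → 3 := fun h k => IsBSmall.dfinsupp_left fun j => h j k
  tfae_have 3 → 1 := fun h => IsBSmall.dfinsupp_right h
  tfae_have 4 ↔ 5 := forall₂_congr fun _ _ => isBSmall_iff_forall_isOmegaFiltration
  tfae_finish
end

section
/- Let 𝓜 be a finite family of abelian groups and M = ⊕𝓜 its direct sum. The following are equivalent: (1) M is self-small; (2) N₁ is N₂-small for every pair N₁, N₂ ∈ 𝓜; (3) for every N₁, N₂ ∈ 𝓜 and every ω-filtration (M_i)_{i<ω} of N₁, there exists i < ω with Hom(N₁/M_i, N₂) = 0. -/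
/-- Smallness passes to quotients of the source and to subgroups of the target. -/
theorem IsBSmall.of_surjective_of_injective {A A' B B' : Type*} [AddCommGroup A]
    [AddCommGroup A'] [AddCommGroup B] [AddCommGroup B'] (h : IsBSmall A' B')
    (p : A' →+ A) (hp : Function.Surjective p) (q : B →+ B') (hq : Function.Injective q) :
    IsBSmall A B := by
  intro I f
  obtain ⟨F, hF⟩ := h I
    (((DFinsupp.mapRange.addMonoidHom fun _ : I => q).comp f).comp p)
  refine ⟨F, fun a i hi => ?_⟩
  obtain ⟨a, rfl⟩ := hp a
  exact (map_eq_zero_iff q hq).1 (by simpa using hF a i hi)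

theorem isBSmall_dfinsupp {ι κ : Type*} [Finite ι] [Finite κ] {A : ι → Type*} {B : κ → Type*}
    [∀ i, AddCommGroup (A i)] [∀ k, AddCommGroup (B k)] (h : ∀ i k, IsBSmall (A i) (B k)) :
    IsBSmall (Π₀ i, A i) (Π₀ k, B k) := by
  classical
  have := Fintype.ofFinite ι
  have := Fintype.ofFinite κ
  intro I f
  choose F hF using fun j k => h j k I
    (((DFinsupp.mapRange.addMonoidHom fun _ : I => DFinsupp.evalAddMonoidHom k).comp f).comp
      (DFinsupp.singleAddHom A j))
  refine ⟨Finset.univ.biUnion fun j => Finset.univ.biUnion (F j), fun a i hi => ?_⟩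
  have hzero : (DFinsupp.evalAddMonoidHom i).comp f = 0 := by
    refine DFinsupp.addHom_ext fun j x => DFinsupp.ext fun k => ?_
    have hi' : i ∉ F j k := fun hik => hi (by
      simp only [Finset.mem_biUnion, Finset.mem_univ, true_and]
      exact ⟨j, k, hik⟩)
    exact hF j k x i hi'
  exact DFunLike.congr_fun hzero a

theorem IsOmegaFiltration.monotone {A : Type*} [AddCommGroup A] {C : ℕ → AddSubgroup A}
    (hC : IsOmegaFiltration C) : Monotone C :=
  monotone_nat_of_le_succ hC.1

theorem IsBSmall.exists_forall_hom_quotient_eq_zero {A B : Type*} [AddCommGroup A]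
    [AddCommGroup B] (h : IsBSmall A B) {C : ℕ → AddSubgroup A} (hC : IsOmegaFiltration C) :
    ∃ i, ∀ g : (A ⧸ C i) →+ B, g = 0 := by
  classical
  by_contra! hne
  choose g hg using hne
  have hvanish (a : A) : ∃ n, ∀ m, n ≤ m → g m a = 0 := by
    obtain ⟨n, hn⟩ := hC.2 a
    refine ⟨n, fun m hm => ?_⟩
    rw [(QuotientAddGroup.eq_zero_iff a).2 (hC.monotone hm hn), map_zero]
  choose N hN using hvanish
  have hval (a : A) (m : ℕ) :
      (DFinsupp.mk (Finset.range (N a)) fun m => g m a : Π₀ _ : ℕ, B) m = g m a := by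
    rw [DFinsupp.mk_apply]
    split_ifs with hm
    · rfl
    · exact (hN a m (by simpa using hm)).symm
  let f : A →+ Π₀ _ : ℕ, B := AddMonoidHom.mk'
    (fun a => DFinsupp.mk (Finset.range (N a)) fun m => g m a) fun a b => by
      ext m
      rw [DFinsupp.add_apply, hval, hval, hval, QuotientAddGroup.mk_add, map_add]
  obtain ⟨F, hF⟩ := h ℕ f
  obtain ⟨i, hi⟩ := Infinite.exists_notMem_finset F
  refine hg i (QuotientAddGroup.addMonoidHom_ext _ (AddMonoidHom.ext fun a => ?_))
  exact (hval a i).symm.trans (hF a i hi)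

theorem isBSmall_of_forall_filtration {A B : Type*} [AddCommGroup A] [AddCommGroup B]
    (h : ∀ C : ℕ → AddSubgroup A, IsOmegaFiltration C →
      ∃ i, ∀ g : (A ⧸ C i) →+ B, g = 0) : IsBSmall A B := by
  classical
  intro I f
  let S : Set I := {i | ∃ a, f a i ≠ 0}
  by_cases hS : S.Finite
  · refine ⟨hS.toFinset, fun a i hi => ?_⟩
    by_contra hne
    exact hi (hS.mem_toFinset.2 ⟨a, hne⟩)
  exfalso
  let e : ℕ ↪ S := Set.Infinite.natEmbedding S hS
  let φ (n : ℕ) : A →+ B := (DFinsupp.evalAddMonoidHom (e n : I)).comp f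
  let C (n : ℕ) : AddSubgroup A := ⨅ m ≥ n, (φ m).ker
  have hmem (n : ℕ) (a : A) : a ∈ C n ↔ ∀ m ≥ n, φ m a = 0 := by
    simp [C, AddSubgroup.mem_iInf, AddMonoidHom.mem_ker]
  have hC : IsOmegaFiltration C := by
    refine ⟨fun n a ha => ?_, fun a => ?_⟩
    · exact (hmem _ _).2 fun m hm => (hmem _ _).1 ha m (Nat.le_of_succ_le hm)
    · have hfin : {m : ℕ | φ m a ≠ 0}.Finite := by
        refine ((f a).finite_support.preimage
          (Subtype.val_injective.comp e.injective).injOn).subset ?_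
        exact fun m hm => hm
      obtain ⟨n, hn⟩ := hfin.bddAbove
      refine ⟨n + 1, (hmem _ _).2 fun m hm => ?_⟩
      by_contra hne
      exact absurd (hn hne) (by omega)
  obtain ⟨n, hn⟩ := h C hC
  obtain ⟨a, ha⟩ := (e n).2
  exact ha (DFunLike.congr_fun
    (hn (QuotientAddGroup.lift (C n) (φ n) fun x hx => (hmem n x).1 hx n le_rfl))
    (a : A ⧸ C n))

/-- For a finite family `𝓜 = (M j)_{j ∈ ι}` of abelian groups with direct
sum `M = ⊕𝓜`, the following are equivalent: (1) `M` is self-small; (2) `M j₁` is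
`M j₂`-small for every `j₁, j₂`; (3) for every `j₁, j₂` and every ω-filtration `(C i)` of
`M j₁` there is `i` with `Hom(M j₁ / C i, M j₂) = 0`. -/
theorem finite_sum_selfSmall_tfae (ι : Type) [Finite ι]
    (M : ι → Type) [∀ j, AddCommGroup (M j)] :
    List.TFAE
      [ IsSelfSmall (Π₀ j, M j),
        ∀ j₁ j₂, IsBSmall (M j₁) (M j₂),
        ∀ (j₁ j₂ : ι) (C : ℕ → AddSubgroup (M j₁)), IsOmegaFiltration C →
          ∃ i : ℕ, ∀ g : (M j₁ ⧸ C i) →+ M j₂, g = 0 ] := by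
  classical
  tfae_have 1 → 2 := by
    intro h j₁ j₂
    have hsurj : Function.Surjective (DFinsupp.evalAddMonoidHom j₁ : (Π₀ j, M j) →+ M j₁) :=
      fun x => ⟨DFinsupp.single j₁ x, by simp [DFinsupp.evalAddMonoidHom]⟩
    exact IsBSmall.of_surjective_of_injective h _ hsurj
      (DFinsupp.singleAddHom M j₂) DFinsupp.single_injective
  tfae_have 2 → 1 := isBSmall_dfinsupp
  tfae_have 2 → 3 := fun h j₁ j₂ _ hC => (h j₁ j₂).exists_forall_hom_quotient_eq_zero hC
  tfae_have 3 → 2 := fun h j₁ j₂ => isBSmall_of_forall_filtration (h j₁ j₂)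
  tfae_finish
end

section
/- For each prime p let A_p be a finite abelian p-group. Then the direct product ∏_{p prime} A_p is self-small. -/
/-- If `x` is killed by `m` and `n` is coprime to `m`, then `x` is divisible by `n`. -/
theorem exists_nsmul_eq_of_coprime {B : Type*} [AddCommGroup B] {m n : ℕ} (h : Nat.Coprime n m)
    {x : B} (hx : m • x = 0) : ∃ y : B, n • y = x := by
  refine ⟨Nat.gcdA n m • x, ?_⟩
  have hb := Nat.gcd_eq_gcd_ab n m
  rw [h.gcd_eq_one] at hb
  calc n • Nat.gcdA n m • x = ((n : ℤ) * Nat.gcdA n m) • x := by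
        rw [mul_smul, natCast_zsmul]
    _ = ((n : ℤ) * Nat.gcdA n m + m * Nat.gcdB n m) • x := by
        rw [add_smul, mul_comm (m : ℤ), mul_smul (Nat.gcdB n m), natCast_zsmul, hx, smul_zero,
          add_zero]
    _ = x := by rw [← hb]; simp

/-- A finite abelian `p`-group is killed by a single power of `p`. -/
theorem exists_pow_nsmul_eq_zero_of_finite {B : Type*} [AddCommGroup B] [Finite B] {p : ℕ}
    (h : ∀ x : B, ∃ n : ℕ, p ^ n • x = 0) : ∃ k : ℕ, ∀ x : B, p ^ k • x = 0 := by
  choose e he using h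
  obtain ⟨k, hk⟩ := Set.finite_range e |>.bddAbove
  refine ⟨k, fun x => ?_⟩
  obtain ⟨c, rfl⟩ := Nat.exists_eq_add_of_le (hk ⟨x, rfl⟩)
  rw [pow_add, mul_comm, mul_smul, he, smul_zero]

/-- A homomorphism from `∏ A p` to `A p` factors through the projection to `A p`. -/
theorem map_eq_zero_of_apply_eq_zero {A : Nat.Primes → Type*}
    [∀ p, AddCommGroup (A p)] [∀ p, Finite (A p)]
    (hA : ∀ (p : Nat.Primes) (x : A p), ∃ n : ℕ, (p : ℕ) ^ n • x = 0)
    {p : Nat.Primes} (g : (∀ q, A q) →+ A p) {a : ∀ q, A q} (ha : a p = 0) : g a = 0 := by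
  obtain ⟨k, hk⟩ := exists_pow_nsmul_eq_zero_of_finite (hA p)
  have hdiv : ∀ q, ∃ y : A q, (p : ℕ) ^ k • y = a q := by
    intro q
    by_cases hq : q = p
    · subst hq
      exact ⟨0, by rw [ha, smul_zero]⟩
    · obtain ⟨n, hn⟩ := hA q (a q)
      refine exists_nsmul_eq_of_coprime (Nat.Coprime.pow k n ?_) hn
      exact (Nat.coprime_primes p.2 q.2).2 fun h => hq (Subtype.ext h.symm)
  choose b hb using hdiv
  have hab : a = (p : ℕ) ^ k • b := funext fun q => (hb q).symm
  rw [hab, map_nsmul, hk]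

/-- If for each prime `p`, `A p` is a finite abelian `p`-group, then the
direct product `∏_{p prime} A p` is self-small. -/
theorem prod_finite_pGroups_selfSmall (A : Nat.Primes → Type)
    [∀ p, AddCommGroup (A p)] [∀ p, Finite (A p)]
    (hA : ∀ (p : Nat.Primes) (x : A p), ∃ n : ℕ, (p : ℕ) ^ n • x = 0) :
    IsSelfSmall (∀ p, A p) := by
  classical
  intro I f
  have hcongr : ∀ (i : I) (p : Nat.Primes) (a b : ∀ q, A q), a p = b p → f a i p = f b i p := by
    intro i p a b hab
    have h := map_eq_zero_of_apply_eq_zero hA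
      ((Pi.evalAddMonoidHom A p).comp ((DFinsupp.evalAddMonoidHom i).comp f))
      (a := a - b) (by simp [hab])
    rw [map_sub, sub_eq_zero] at h
    exact h
  let S : Nat.Primes → Set I := fun p => {i | ∃ a, f a i p ≠ 0}
  have hS : ∀ p, (S p).Finite := by
    intro p
    refine (Set.finite_iUnion fun x : A p => (f (Pi.single p x)).finite_support).subset ?_
    rintro i ⟨a, ha⟩
    refine Set.mem_iUnion.2 ⟨a p, fun h => ha ?_⟩
    rw [hcongr i p a (Pi.single p (a p)) (by simp), h, Pi.zero_apply]
  suffices hfin : (⋃ p, S p).Finite by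
    refine ⟨hfin.toFinset, fun a i hi => ?_⟩
    by_contra hne
    obtain ⟨p, hp⟩ := Function.ne_iff.1 hne
    exact hi (hfin.mem_toFinset.2 (Set.mem_iUnion.2 ⟨p, a, hp⟩))
  have hm : ∀ i : ↥(⋃ p, S p), ∃ p, (i : I) ∈ S p := fun i => Set.mem_iUnion.1 i.2
  choose m hm using hm
  choose w hw using hm
  -- A section `s` of `m` gives one index for each prime in the range of `m`.
  choose s hs using fun p : Set.range m => p.2
  let a : ∀ p, A p := fun p => if h : p ∈ Set.range m then w (s ⟨p, h⟩) p else 0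
  have hsupp : ∀ p : Set.range m, f a (s p) ≠ 0 := by
    intro p h
    have hwp := hw (s p)
    rw [hs p] at hwp
    apply hwp
    rw [← hcongr _ _ a _ (dif_pos p.2), h, Pi.zero_apply]
  have hinj : Function.Injective fun p => (s p : I) := by
    intro p q hpq
    apply Subtype.ext
    rw [← hs p, ← hs q, Subtype.ext hpq]
  have hrange : (Set.range m).Finite := by
    have := (f a).finite_support.to_subtype
    exact Set.finite_coe_iff.1 <| Finite.of_injective
      (β := {i | f a i ≠ 0}) (fun p : Set.range m => ⟨s p, hsupp p⟩)
      fun p q h => hinj (Subtype.mk.inj h)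
  refine (hrange.biUnion fun p _ => hS p).subset fun i hi => ?_
  exact Set.mem_biUnion ⟨⟨i, hi⟩, rfl⟩ ⟨_, hw ⟨i, hi⟩⟩
end

section
/- For every cardinal κ, the direct product ℤ^{κ} of κ copies of the group of integers ℤ is ℤ-small; consequently, ℤ^{κ} is self-small. -/
namespace BaerSpecker

/-- A homomorphism `ℤ^ℕ → G` killing the unit vectors kills all finitely supported sequences. -/
lemma map_eq_zero_of_eventually_zero {G : Type*} [AddCommGroup G] (h : (ℕ → ℤ) →+ G)
    (hs : ∀ n, h (Pi.single n 1) = 0) (N : ℕ) (x : ℕ → ℤ) (hx : ∀ n, N ≤ n → x n = 0) :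
    h x = 0 := by
  have key : x = ∑ n ∈ Finset.range N, x n • (Pi.single n 1 : ℕ → ℤ) := by
    funext k
    simp only [Finset.sum_apply, Pi.smul_apply, Pi.single_apply, smul_eq_mul, mul_ite, mul_one,
      mul_zero, Finset.sum_ite_eq, Finset.mem_range]
    split_ifs with hk
    · rfl
    · exact hx k (not_lt.mp hk)
  rw [key, map_sum]
  exact Finset.sum_eq_zero fun n _ => by rw [map_zsmul, hs, smul_zero]

lemma map_pow_mul_eq_zero (h : (ℕ → ℤ) →+ ℤ) (hs : ∀ n, h (Pi.single n 1) = 0)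
    (p : ℕ) (hp : 2 ≤ p) (u : ℕ → ℤ) : h (fun n => (p : ℤ) ^ n * u n) = 0 := by
  have hdvd : ∀ N : ℕ, (p : ℤ) ^ N ∣ h (fun n => (p : ℤ) ^ n * u n) := by
    intro N
    have hsplit : (fun n => (p : ℤ) ^ n * u n) =
        (fun n => if n < N then (p : ℤ) ^ n * u n else 0) +
          (p : ℤ) ^ N • (fun n => if n < N then 0 else (p : ℤ) ^ (n - N) * u n) := by
      funext n
      simp only [Pi.add_apply, Pi.smul_apply, smul_eq_mul]
      split_ifs with hn
      · simp
      · rw [zero_add, ← mul_assoc, ← pow_add, Nat.add_sub_cancel' (not_lt.mp hn)]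
    rw [hsplit, map_add, map_zsmul,
      map_eq_zero_of_eventually_zero h hs N _ fun n hn => if_neg (not_lt.mpr hn), zero_add,
      smul_eq_mul]
    exact dvd_mul_right _ _
  set z := h (fun n => (p : ℤ) ^ n * u n)
  refine Int.eq_zero_of_abs_lt_dvd (hdvd z.natAbs) ?_
  rw [Int.abs_eq_natAbs]
  exact_mod_cast Nat.lt_pow_self (by omega)

/-- A homomorphism `ℤ^ℕ → ℤ` killing the unit vectors is zero. -/
lemma map_eq_zero_of_single (h : (ℕ → ℤ) →+ ℤ) (hs : ∀ n, h (Pi.single n 1) = 0)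
    (x : ℕ → ℤ) : h x = 0 := by
  have hcop : ∀ n : ℕ, IsCoprime ((2 : ℕ) ^ n : ℤ) ((3 : ℕ) ^ n : ℤ) := fun n =>
    IsCoprime.pow (by norm_num [Int.isCoprime_iff_gcd_eq_one])
  choose a b hab using hcop
  have hx : x = (fun n => ((2 : ℕ) : ℤ) ^ n * (a n * x n)) +
      (fun n => ((3 : ℕ) : ℤ) ^ n * (b n * x n)) := by
    funext n
    simp only [Pi.add_apply]
    linear_combination (-x n) * hab n
  rw [hx, map_add, map_pow_mul_eq_zero h hs 2 le_rfl, map_pow_mul_eq_zero h hs 3 (by norm_num),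
    add_zero]

lemma exists_not_zsmul {g : ℕ →₀ ℤ} (hg : g ≠ 0) : ∃ m : ℤ, m ≠ 0 ∧ ∀ y, g ≠ m • y := by
  obtain ⟨i, hi⟩ := Finsupp.ne_iff.mp hg
  rw [Finsupp.zero_apply] at hi
  refine ⟨2 * g i, by simpa using hi, fun y hy => ?_⟩
  have h1 := DFunLike.congr_fun hy i
  rw [Finsupp.smul_apply, smul_eq_mul] at h1
  have h2 : g i * (2 * y i - 1) = 0 := by linear_combination -h1
  rcases mul_eq_zero.mp h2 with h3 | h3
  · exact hi h3
  · omega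

/-- Slenderness of the free abelian group of countable rank. -/
lemma exists_map_single_eq_zero (h : (ℕ → ℤ) →+ (ℕ →₀ ℤ)) : ∃ n, h (Pi.single n 1) = 0 := by
  by_contra! hne
  choose m hm0 hm using fun n => exists_not_zsmul (hne n)
  let c : ℕ → ℤ := fun k => ∏ j ∈ Finset.range k, m j
  have hc0 : ∀ k, c k ≠ 0 := fun k => Finset.prod_ne_zero_iff.mpr fun j _ => hm0 j
  have hcs : ∀ k, c (k + 1) = c k * m k := fun k => Finset.prod_range_succ _ _
  have hcd : ∀ k l, k ≤ l → c k ∣ c l := fun k l hkl =>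
    Finset.prod_dvd_prod_of_subset _ _ _ (Finset.range_mono hkl)
  let e : Set ℕ → ℕ → ℤ := fun s n => c n * s.indicator 1 n
  have hninj : ¬ Function.Injective fun s : Set ℕ => h (e s) := by
    intro hinj
    have : Countable (Set ℕ) := hinj.countable
    exact Function.cantor_injective _
      ((Countable.exists_injective_nat (Set ℕ)).choose_spec)
  simp only [Function.Injective, not_forall] at hninj
  obtain ⟨s, t, hst, hne'⟩ := hninj
  have hex : ∃ n, s.indicator (1 : ℕ → ℤ) n - t.indicator 1 n ≠ 0 := by
    by_contra! hall
    refine hne' (Set.ext fun n => ?_)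
    have := hall n
    by_cases h1 : n ∈ s <;> by_cases h2 : n ∈ t <;> simp_all
  classical
  let k := Nat.find hex
  have hk : s.indicator (1 : ℕ → ℤ) k - t.indicator 1 k ≠ 0 := Nat.find_spec hex
  have hlt : ∀ j < k, s.indicator (1 : ℕ → ℤ) j - t.indicator 1 j = 0 := fun j hj =>
    not_not.mp (Nat.find_min hex hj)
  set ε := s.indicator (1 : ℕ → ℤ) k - t.indicator 1 k with hε
  have hεsq : ε * ε = 1 := by
    rw [hε] at hk ⊢
    by_cases h1 : k ∈ s <;> by_cases h2 : k ∈ t <;> simp_all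
  choose q hq using hcd (k + 1)
  let w : ℕ → ℤ := fun n => if hn : k + 1 ≤ n then
    q n hn * (s.indicator (1 : ℕ → ℤ) n - t.indicator 1 n) else 0
  have hdecomp : e s - e t = c k • (ε • (Pi.single k 1 : ℕ → ℤ) + m k • w) := by
    funext n
    simp only [e, w, Pi.sub_apply, Pi.smul_apply, Pi.add_apply, smul_eq_mul]
    rcases lt_trichotomy n k with hn | rfl | hn
    · rw [dif_neg (by omega), Pi.single_eq_of_ne hn.ne]
      linear_combination c n * hlt n hn
    · rw [dif_neg (by omega), Pi.single_eq_same, hε]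
      ring
    · rw [dif_pos (by omega), Pi.single_eq_of_ne hn.ne', ← mul_sub]
      have h1 := hq n (by omega)
      rw [hcs] at h1
      rw [h1]
      ring
  have h0 : c k • (ε • h (Pi.single k 1) + m k • h w) = 0 := by
    rw [← map_zsmul h, ← map_zsmul h, ← map_add, ← map_zsmul h, ← hdecomp, map_sub]
    exact sub_eq_zero.mpr hst
  have h1 := (smul_eq_zero.mp h0).resolve_left (hc0 k)
  refine hm k (-ε • h w) ?_
  calc h (Pi.single k 1) = (ε * ε) • h (Pi.single k 1) := by rw [hεsq, one_smul]
    _ = ε • (ε • h (Pi.single k 1)) := mul_smul _ _ _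
    _ = ε • (-(m k • h w)) := by rw [eq_neg_of_add_eq_zero_left h1]
    _ = m k • (-ε • h w) := by rw [smul_neg, neg_smul, smul_neg, smul_comm]

/-- The homomorphism `ℤ^ℕ → ℤ^K` spreading `x n` over the fibre of `ν` at `n`, weighted by `b`. -/
def spread {K : Type*} (ν : K → ℕ) (b : K → ℤ) : (ℕ → ℤ) →+ (K → ℤ) where
  toFun x k := x (ν k) * b k
  map_zero' := by funext k; simp
  map_add' x y := by funext k; simp [add_mul]

lemma spread_single {K : Type*} (ν : K → ℕ) (b : K → ℤ) (n : ℕ) :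
    spread ν b (Pi.single n 1) = (ν ⁻¹' {n}).indicator b := by
  classical
  funext k
  by_cases hk : ν k = n <;> simp [spread, Set.indicator, hk]

variable {K : Type*}

/-- Along a decreasing sequence of subsets of `K`, some difference of consecutive terms is
negligible for a given homomorphism to a free group of countable rank. -/
lemma exists_indicator_diff_eq_zero (f : (K → ℤ) →+ (ℕ →₀ ℤ)) (A : ℕ → Set K)
    (hA : Antitone A) : ∃ n, ∀ a : K → ℤ, f ((A n \ A (n + 1)).indicator a) = 0 := by
  by_contra! hne
  choose a ha using hne
  have hν : ∀ k, ∃ n, ∀ j, k ∈ A j \ A (j + 1) → n = j := by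
    intro k
    by_cases hk : ∃ n, k ∈ A n \ A (n + 1)
    · obtain ⟨n, hn⟩ := hk
      refine ⟨n, fun j hj => ?_⟩
      rcases lt_trichotomy n j with h | h | h
      · exact absurd (hA (Nat.succ_le_of_lt h) hj.1) hn.2
      · exact h
      · exact absurd (hA (Nat.succ_le_of_lt h) hn.1) hj.2
    · exact ⟨0, fun j hj => absurd ⟨j, hj⟩ hk⟩
  choose ν hν using hν
  let b : K → ℤ := fun k => (A (ν k) \ A (ν k + 1)).indicator (a (ν k)) k
  obtain ⟨n, hn⟩ := exists_map_single_eq_zero (f.comp (spread ν b))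
  refine ha n ?_
  rw [AddMonoidHom.comp_apply, spread_single] at hn
  rw [← hn]
  congr 1
  funext k
  by_cases hk : ν k = n
  · subst hk
    simp [b, Set.indicator]
  · rw [Set.indicator_of_notMem (fun h => hk (hν k n h)),
      Set.indicator_of_notMem (show k ∉ ν ⁻¹' {n} from hk)]

/-- The coordinates at which `f` does not vanish on functions supported in `A`. -/
def coords (f : (K → ℤ) →+ (ℕ →₀ ℤ)) (A : Set K) : Set ℕ :=
  {n | ∃ a : K → ℤ, f (A.indicator a) n ≠ 0}

lemma indicator_split {A B : Set K} (hB : B ⊆ A) (a : K → ℤ) :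
    A.indicator a = B.indicator a + (A \ B).indicator a := by
  funext k
  by_cases h1 : k ∈ A <;> by_cases h2 : k ∈ B <;> simp [h1, h2]
  exact absurd (hB h2) h1

lemma coords_subset_union (f : (K → ℤ) →+ (ℕ →₀ ℤ)) {A B : Set K} (hB : B ⊆ A) :
    coords f A ⊆ coords f B ∪ coords f (A \ B) := by
  rintro n ⟨a, ha⟩
  by_contra hn
  simp only [coords, Set.mem_union, Set.mem_ofPred_eq, not_or, not_exists, not_not] at hn
  apply ha
  rw [indicator_split hB, map_add, Finsupp.add_apply, hn.1, hn.2, add_zero]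

/-- If every infinite-coordinate subset of `A` has negligible complement in `A`, then `f` is
determined on functions supported in `A` by its value at the indicator of `A`. -/
lemma map_indicator_mem_zmultiples (f : (K → ℤ) →+ (ℕ →₀ ℤ)) (A : Set K)
    (hinf : (coords f A).Infinite)
    (hA : ∀ B ⊆ A, (coords f B).Infinite → ∀ a : K → ℤ, f ((A \ B).indicator a) = 0)
    (a : K → ℤ) : ∃ c : ℤ, f (A.indicator a) = c • f (A.indicator 1) := by
  by_cases hc : ∃ c : ℤ, (coords f (A ∩ a ⁻¹' {c})).Infinite
  · obtain ⟨c, hc⟩ := hc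
    refine ⟨c, ?_⟩
    have h0 := hA _ Set.inter_subset_left hc
    rw [indicator_split (Set.inter_subset_left (t := a ⁻¹' {c})) a,
      indicator_split (Set.inter_subset_left (t := a ⁻¹' {c})) 1, map_add, map_add, h0, h0,
      add_zero, add_zero, ← map_zsmul]
    congr 1
    funext k
    by_cases hk : k ∈ A ∩ a ⁻¹' {c}
    · have : a k = c := hk.2
      simp [hk, this]
    · simp [hk]
  · refine ⟨0, ?_⟩
    rw [zero_smul]
    simp only [not_exists, Set.not_infinite] at hc
    have hsmall : ∀ c : ℤ, ∀ x : K → ℤ, f ((A ∩ a ⁻¹' {c}).indicator x) = 0 := by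
      intro c x
      have hbig : (coords f (A \ (A ∩ a ⁻¹' {c}))).Infinite := fun hfin =>
        hinf (((hc c).union hfin).subset (coords_subset_union f Set.inter_subset_left))
      have := hA _ Set.sdiff_subset hbig x
      rwa [Set.sdiff_sdiff_cancel_left Set.inter_subset_left] at this
    let E : ℤ ≃ ℕ := Denumerable.eqv ℤ
    have hspread : A.indicator a = spread (E ∘ a) (A.indicator 1) E.symm := by
      funext k
      by_cases hk : k ∈ A <;> simp [spread, hk]
    ext n
    rw [hspread]
    refine map_eq_zero_of_single
      ((Finsupp.applyAddHom n).comp (f.comp (spread (E ∘ a) (A.indicator 1)))) (fun j => ?_) _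
    have hfib : (E ∘ a ⁻¹' {j}).indicator (A.indicator (1 : K → ℤ)) =
        (A ∩ a ⁻¹' {E.symm j}).indicator 1 := by
      rw [Set.indicator_indicator, Set.inter_comm]
      congr 2
      ext k
      simp [Equiv.eq_symm_apply]
    simp only [AddMonoidHom.comp_apply, spread_single, hfib, hsmall, map_zero]

lemma finite_coords_univ (f : (K → ℤ) →+ (ℕ →₀ ℤ)) : (coords f Set.univ).Finite := by
  by_contra hinf
  by_cases hstep : ∀ A : Set K, (coords f A).Infinite → ∃ B ⊆ A, (coords f B).Infinite ∧
      ∃ a : K → ℤ, f ((A \ B).indicator a) ≠ 0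
  · choose! next hsub hnext hbig using hstep
    let A : ℕ → Set K := fun n => next^[n] Set.univ
    have hAs : ∀ n, A (n + 1) = next (A n) := fun n => Function.iterate_succ_apply' _ _ _
    have hAinf : ∀ n, (coords f (A n)).Infinite := by
      intro n
      induction n with
      | zero => exact hinf
      | succ n ih => rw [hAs]; exact hnext _ ih
    have hanti : Antitone A := antitone_nat_of_succ_le fun n => by
      rw [hAs]; exact hsub _ (hAinf n)
    obtain ⟨n, hn⟩ := exists_indicator_diff_eq_zero f A hanti
    obtain ⟨a, ha⟩ := hbig _ (hAinf n)
    exact ha (hAs n ▸ hn a)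
  · push Not at hstep
    obtain ⟨A, hAinf, hA⟩ := hstep
    refine hAinf ((f (A.indicator 1)).support.finite_toSet.subset ?_)
    rintro n ⟨a, ha⟩
    obtain ⟨c, hc⟩ := map_indicator_mem_zmultiples f A hAinf hA a
    rw [hc, Finsupp.smul_apply] at ha
    exact Finsupp.mem_support_iff.mpr (right_ne_zero_of_smul ha)

/-- A pointwise finite sequence of homomorphisms `ℤ^K → ℤ` contains a zero term. -/
lemma exists_eq_zero_of_pointwise_finite (g : ℕ → (K → ℤ) →+ ℤ)
    (hg : ∀ a, {n | g n a ≠ 0}.Finite) : ∃ n, g n = 0 := by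
  let f : (K → ℤ) →+ (ℕ →₀ ℤ) :=
    { toFun := fun a => Finsupp.ofSupportFinite (fun n => g n a) (hg a)
      map_zero' := Finsupp.ext fun n => map_zero (g n)
      map_add' := fun a b => Finsupp.ext fun n => map_add (g n) a b }
  obtain ⟨n, hn⟩ := (finite_coords_univ f).exists_notMem
  refine ⟨n, AddMonoidHom.ext fun a => ?_⟩
  by_contra ha
  exact hn ⟨a, by rwa [Set.indicator_univ]⟩

/-- `ℤ^K` is `B`-small whenever the homomorphisms `B → ℤ` separate the points of `B`. -/
lemma isBSmall_of_separating {B : Type*} [AddCommGroup B]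
    (hB : ∀ b : B, b ≠ 0 → ∃ φ : B →+ ℤ, φ b ≠ 0) : IsBSmall (K → ℤ) B := by
  intro I f
  have hfin : {i | ∃ a, f a i ≠ 0}.Finite := by
    by_contra hinf
    let ι := Set.Infinite.natEmbedding _ hinf
    choose a ha using fun n => (ι n).2
    choose φ hφ using fun n => hB _ (ha n)
    obtain ⟨n, hn⟩ := exists_eq_zero_of_pointwise_finite
      (fun n => (φ n).comp ((DFinsupp.evalAddMonoidHom (ι n : I)).comp f)) (fun x => by
        classical
        refine ((f x).support.finite_toSet.preimage
          (Subtype.val_injective.comp ι.injective).injOn).subset fun n hn => ?_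
        refine DFinsupp.mem_support_iff.mpr fun h0 => hn ?_
        change φ n (f x (ι n)) = 0
        rw [← map_zero (φ n)]
        exact congrArg _ h0)
    exact hφ n (DFunLike.congr_fun hn (a n))
  refine ⟨hfin.toFinset, fun a i hi => ?_⟩
  by_contra h
  exact hi (hfin.mem_toFinset.mpr ⟨a, h⟩)

end BaerSpecker

/-- For every cardinal `κ` (realized as a type `K`), the direct product
`ℤ^κ` is `ℤ`-small; consequently `ℤ^κ` is self-small. -/
theorem prod_int_int_small_and_selfSmall (K : Type) :
    IsBSmall (K → ℤ) ℤ ∧ IsSelfSmall (K → ℤ) := by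
  refine ⟨BaerSpecker.isBSmall_of_separating fun b hb => ⟨AddMonoidHom.id ℤ, hb⟩,
    BaerSpecker.isBSmall_of_separating fun b hb => ?_⟩
  obtain ⟨k, hk⟩ := Function.ne_iff.mp hb
  exact ⟨Pi.evalAddMonoidHom _ k, hk⟩
end
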